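/- Fix a real a > 0 and an integer s ≥ 1. For each sufficiently small ε > 0, let x(ε) ∈ [0,1) be the unique solution of g(x(ε)) = (1/12)(1 − a^4 ε^4/36). Then as ε → 0⁺, R_s(x(ε)) = 2 − 4/((s+1)(s+2)) − (s(s+3)(3s^2+9s−2) a^4 ε^4)/(180 (s+1)(s+2)) + (s(s+3)(5s^4+30s^3+59s^2+42s+4) a^6 ε^6)/(7560 (s+1)(s+2)) + O(ε^8). -/

import Mathlib

/-- The map `g(x) = x(1+x+x²)/(1+4x+x²)²`. -/
noncomputable def gfun (x : ℝ) : ℝ := x * (1 + x + x ^ 2) / (1 + 4 * x + x ^ 2) ^ 2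

/-- `R_s(x)`. -/
noncomputable def Rfun (s : ℕ) (x : ℝ) : ℝ :=
  ((1 + 4 * x + x ^ 2) / (1 + x + x ^ 2)) *
    ((1 - x ^ s) * (1 - x ^ (s + 3))) / ((1 - x ^ (s + 1)) * (1 - x ^ (s + 2)))

/-- The polynomials `P_n(u)`, `u = (1-x)^2/x`, with
`(1 - x^(n+1)) (1 - x^(n+2)) = (1+x) x^(n+1) u P_n(u)`. -/
noncomputable def auxP : ℕ → ℝ → ℝ
  | 0, _ => 1
  | 1, u => 3 + u
  | (n + 2), u => 1 + (2 + u) * auxP (n + 1) u - auxP n u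

/-- Cubic coefficient of `P_n`. -/
noncomputable def auxc (s : ℝ) : ℝ :=
  (s + 5) * (s + 4) * (s + 3) * (s + 2) * (s + 1) * s * (s - 1) * (s - 2) / 40320

/-- The remainder after the cubic term of `P_n`. -/
noncomputable def auxE : ℕ → ℝ → ℝ
  | 0, _ => 0
  | 1, _ => 0
  | (n + 2), u => (2 + u) * auxE (n + 1) u - auxE n u + auxc ((n : ℝ) + 1)

lemma auxE_cont (n : ℕ) : Continuous (auxE n) ∧ Continuous (auxE (n + 1)) := by
  induction n with
  | zero =>
    constructor
    · have : auxE 0 = fun _ => 0 := by funext u; simp [auxE]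
      rw [this]; fun_prop
    · have : auxE (0 + 1) = fun _ => 0 := by funext u; simp [auxE]
      rw [this]; fun_prop
  | succ k ih =>
    obtain ⟨h1, h2⟩ := ih
    refine ⟨h2, ?_⟩
    have : auxE (k + 1 + 1) =
        fun u => (2 + u) * auxE (k + 1) u - auxE k u + auxc ((k : ℝ) + 1) := by
      funext u; rw [auxE]
    rw [this]; fun_prop

lemma auxP_ge (n : ℕ) (u : ℝ) (hu : 0 ≤ u) :
    1 ≤ auxP n u ∧ auxP n u ≤ auxP (n + 1) u := by
  induction n with
  | zero => simp only [auxP]; constructor <;> linarith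
  | succ k ih =>
    obtain ⟨h1, h2⟩ := ih
    refine ⟨by linarith, ?_⟩
    rw [show auxP (k + 1 + 1) u = 1 + (2 + u) * auxP (k + 1) u - auxP k u by rw [auxP]]
    have : 0 ≤ u * auxP (k + 1) u := mul_nonneg hu (by linarith)
    linarith

/-- Taylor formula for `P_n`. -/
def auxTaylor (n : ℕ) (u : ℝ) : Prop :=
  auxP n u = ((n : ℝ) + 2) * (n + 1) / 2 + ((n : ℝ) + 3) * (n + 2) * (n + 1) * n / 24 * u
    + ((n : ℝ) + 4) * (n + 3) * (n + 2) * (n + 1) * n * (n - 1) / 720 * u ^ 2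
    + auxc n * u ^ 3 + auxE n u * u ^ 4

lemma auxP_taylor (n : ℕ) (u : ℝ) : auxTaylor n u ∧ auxTaylor (n + 1) u := by
  induction n with
  | zero =>
    unfold auxTaylor
    constructor <;> simp [auxP, auxE, auxc] <;> ring
  | succ k ih =>
    obtain ⟨h1, h2⟩ := ih
    refine ⟨h2, ?_⟩
    unfold auxTaylor at *
    rw [show auxP (k + 1 + 1) u = 1 + (2 + u) * auxP (k + 1) u - auxP k u by rw [auxP],
      show auxE (k + 1 + 1) u = (2 + u) * auxE (k + 1) u - auxE k u + auxc ((k : ℝ) + 1) by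
        rw [auxE], h1, h2]
    unfold auxc
    push_cast
    ring

lemma auxP_x (x u : ℝ) (h : u * x = (1 - x) ^ 2) (n : ℕ) :
    (1 + x) * x ^ (n + 1) * (1 + u * auxP n u) = 1 + x ^ (2 * n + 3) ∧
    (1 + x) * x ^ (n + 2) * (1 + u * auxP (n + 1) u) = 1 + x ^ (2 * n + 5) := by
  induction n with
  | zero =>
    simp only [auxP]
    constructor
    · linear_combination (1 + x) * h
    · linear_combination (1 + x) * (3 * x + u * x + (1 - x) ^ 2) * h
  | succ k ih =>
    obtain ⟨h1, h2⟩ := ih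
    refine ⟨?_, ?_⟩
    · rw [show 2 * (k + 1) + 3 = 2 * k + 5 by ring]; exact h2
    · rw [show auxP (k + 1 + 1) u = 1 + (2 + u) * auxP (k + 1) u - auxP k u by rw [auxP]]
      linear_combination (2 * x + u * x) * h2 - x ^ 2 * h1 + (1 + x ^ (2 * k + 5)) * h

/-- The quartic cofactor of the numerator. -/
noncomputable def auxS (s : ℕ) (p0 p1 p2 p3 d0 d1 d2 d3 d4 : ℝ) (u : ℝ) : ℝ :=
  p0 * d4 + p1 * d3 + p2 * d2 + p3 * d1 - 2 + (p1 * d4 + p2 * d3 + p3 * d2) * u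
    + (p2 * d4 + p3 * d3) * u ^ 2 + p3 * d4 * u ^ 3
    + auxE s u * (d0 + d1 * u + d2 * u ^ 2 + d3 * u ^ 3 + d4 * u ^ 4)

lemma aux_main (s : ℕ) (T0 T2 T3 : ℝ)
    (hT0 : T0 = 2 - 4 / (((s:ℝ) + 1) * ((s:ℝ) + 2)))
    (hT2 : T2 = 36 * ((s:ℝ) * ((s:ℝ) + 3) * (3 * (s:ℝ) ^ 2 + 9 * (s:ℝ) - 2)) /
                (180 * (((s:ℝ) + 1) * ((s:ℝ) + 2))))
    (hT3 : T3 = 216 * ((s:ℝ) * ((s:ℝ) + 3) *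
                (5 * (s:ℝ) ^ 4 + 30 * (s:ℝ) ^ 3 + 59 * (s:ℝ) ^ 2 + 42 * (s:ℝ) + 4)) /
                (7560 * (((s:ℝ) + 1) * ((s:ℝ) + 2)))) :
    ∃ S : ℝ → ℝ, Continuous S ∧ ∀ u : ℝ,
      2 * (auxP s u - 1) * (6 + u) ^ 4 - (6 + 2 * u) * auxP s u *
        (T0 * (6 + u) ^ 3 - T2 * u ^ 2 * (6 + u) + T3 * u ^ 3) = u ^ 4 * S u := by
  obtain ⟨p0, hp0⟩ : ∃ p, p = ((s : ℝ) + 2) * (s + 1) / 2 := ⟨_, rfl⟩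
  obtain ⟨p1, hp1⟩ : ∃ p, p = ((s : ℝ) + 3) * (s + 2) * (s + 1) * s / 24 := ⟨_, rfl⟩
  obtain ⟨p2, hp2⟩ : ∃ p, p = ((s : ℝ) + 4) * (s + 3) * (s + 2) * (s + 1) * s * (s - 1) / 720 :=
    ⟨_, rfl⟩
  obtain ⟨p3, hp3⟩ : ∃ p, p = auxc s := ⟨_, rfl⟩
  have hq1 : (s : ℝ) + 1 ≠ 0 := by positivity
  have hq2 : (s : ℝ) + 2 ≠ 0 := by positivity
  obtain ⟨d0, hd0⟩ : ∃ d, d = 2592 - 1296 * T0 := ⟨_, rfl⟩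
  obtain ⟨d1, hd1⟩ : ∃ d, d = 1728 - 1080 * T0 := ⟨_, rfl⟩
  obtain ⟨d2, hd2⟩ : ∃ d, d = 432 - (324 * T0 - 36 * T2) := ⟨_, rfl⟩
  obtain ⟨d3, hd3⟩ : ∃ d, d = 48 - (42 * T0 - 18 * T2 + 6 * T3) := ⟨_, rfl⟩
  obtain ⟨d4, hd4⟩ : ∃ d, d = 2 - 2 * (T0 - T2 + T3) := ⟨_, rfl⟩
  have c0 : p0 * d0 - 2592 = 0 := by
    rw [hp0, hd0, hT0]; field_simp; ring
  have c1 : p0 * d1 + p1 * d0 - 1728 = 0 := by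
    rw [hp0, hp1, hd0, hd1, hT0]; field_simp; ring
  have c2 : p0 * d2 + p1 * d1 + p2 * d0 - 432 = 0 := by
    rw [hp0, hp1, hp2, hd0, hd1, hd2, hT0, hT2]; field_simp; ring
  have c3 : p0 * d3 + p1 * d2 + p2 * d1 + p3 * d0 - 48 = 0 := by
    rw [hp0, hp1, hp2, hp3, hd0, hd1, hd2, hd3, hT0, hT2, hT3, auxc]; field_simp; ring
  refine ⟨auxS s p0 p1 p2 p3 d0 d1 d2 d3 d4, ?_, ?_⟩
  · have := (auxE_cont s).1
    unfold auxS
    fun_prop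
  · intro u
    have hP := (auxP_taylor s u).1
    unfold auxTaylor at hP
    rw [← hp0, ← hp1, ← hp2, ← hp3] at hP
    rw [hP, auxS]
    clear hP hp0 hp1 hp2 hp3 hT0 hT2 hT3
    have key : 2 * (6 + u) ^ 4 - (6 + 2 * u) *
        (T0 * (6 + u) ^ 3 - T2 * u ^ 2 * (6 + u) + T3 * u ^ 3)
        = d0 + d1 * u + d2 * u ^ 2 + d3 * u ^ 3 + d4 * u ^ 4 := by
      rw [hd0, hd1, hd2, hd3, hd4]; ring
    linear_combination (p0 + p1 * u + p2 * u ^ 2 + p3 * u ^ 3 + auxE s u * u ^ 4) * key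
      + c0 + u * c1 + u ^ 2 * c2 + u ^ 3 * c3

/-- `R_s` in terms of `u` and `P_s`. -/
lemma aux_Rfun (s : ℕ) (x u : ℝ) (hx0 : 0 < x) (hx1 : x < 1) (h : u * x = (1 - x) ^ 2) :
    Rfun s x = (6 + u) / (3 + u) * ((auxP s u - 1) / auxP s u) := by
  have hu : 0 < u := by
    have : 0 < (1 - x) ^ 2 := by have : 0 < 1 - x := by linarith
                                 positivity
    rw [← h] at this
    exact pos_of_mul_pos_left this hx0.le
  have hP := (auxP_ge s u hu.le).1
  have hQ := (auxP_x x u h s).1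
  have e1 : (1 - x ^ s) * (1 - x ^ (s + 3)) =
      (1 + x) * x ^ (s + 1) * u * (auxP s u - 1) := by
    linear_combination (-1) * hQ + (1 + x) * x ^ s * h
  have e2 : (1 - x ^ (s + 1)) * (1 - x ^ (s + 2)) =
      (1 + x) * x ^ (s + 1) * u * auxP s u := by
    linear_combination (-1) * hQ
  have e3 : 1 + 4 * x + x ^ 2 = (6 + u) * x := by linear_combination (-1) * h
  have e4 : 1 + x + x ^ 2 = (3 + u) * x := by linear_combination (-1) * h
  have hP0 : auxP s u ≠ 0 := by linarith
  have h3 : 3 + u ≠ 0 := by positivity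
  have hx2 : 1 + x ≠ 0 := by positivity
  unfold Rfun
  rw [e1, e2, e3, e4]
  field_simp

/-- Inverting `g`. -/
lemma aux_g (x d : ℝ) (hx0 : 0 ≤ x) (hd0 : 0 < d) (hd1 : d < 1)
    (hg : gfun x = (1/12) * (1 - d ^ 2)) :
    0 < x ∧ (1 - x) ^ 2 = d * (1 + 4 * x + x ^ 2) := by
  constructor
  · rcases hx0.eq_or_lt with h | h
    · rw [← h] at hg
      simp [gfun] at hg
      nlinarith
    · exact h
  · have hpos : 0 < 1 + 4 * x + x ^ 2 := by positivity
    unfold gfun at hg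
    rw [div_eq_iff (by positivity)] at hg
    have : ((1 - x) ^ 2) ^ 2 = (d * (1 + 4 * x + x ^ 2)) ^ 2 := by
      linear_combination (-12) * hg
    exact (pow_left_inj₀ (by positivity) (by positivity) (by norm_num)).1 this


/-- Local limit expansion of `R_s` when `g = (1/12)(1 − a⁴ε⁴/36)`:
`R_s = 2 − 4/((s+1)(s+2)) − s(s+3)(3s²+9s−2)a⁴ε⁴/(180(s+1)(s+2))
     + s(s+3)(5s⁴+30s³+59s²+42s+4)a⁶ε⁶/(7560(s+1)(s+2)) + O(ε⁸)`. -/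
theorem Rfun_local_expansion (a : ℝ) (ha : 0 < a) (s : ℕ) (hs : 1 ≤ s) :
    ∃ ε₀ > (0:ℝ), ∃ C > (0:ℝ), ∀ ε : ℝ, 0 < ε → ε < ε₀ →
      ∀ x ∈ Set.Ico (0:ℝ) 1, gfun x = (1/12) * (1 - a ^ 4 * ε ^ 4 / 36) →
        |Rfun s x -
          (2 - 4 / (((s:ℝ) + 1) * ((s:ℝ) + 2))
            - (s:ℝ) * ((s:ℝ) + 3) * (3 * (s:ℝ) ^ 2 + 9 * (s:ℝ) - 2) * a ^ 4 * ε ^ 4 /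
                (180 * (((s:ℝ) + 1) * ((s:ℝ) + 2)))
            + (s:ℝ) * ((s:ℝ) + 3) *
                (5 * (s:ℝ) ^ 4 + 30 * (s:ℝ) ^ 3 + 59 * (s:ℝ) ^ 2 + 42 * (s:ℝ) + 4) *
                a ^ 6 * ε ^ 6 / (7560 * (((s:ℝ) + 1) * ((s:ℝ) + 2))))|
          ≤ C * ε ^ 8 := by
  obtain ⟨S, hScont, hS⟩ := aux_main s _ _ _ rfl rfl rfl
  obtain ⟨K, hK⟩ := (isCompact_Icc (a := (0:ℝ)) (b := 1)).exists_bound_of_continuousOn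
    hScont.continuousOn
  have hK0 : 0 ≤ K := (norm_nonneg _).trans (hK 0 (by simp))
  refine ⟨1 / (2 * a), by positivity, 2 * a ^ 8 * (K + 1), by positivity, ?_⟩
  intro ε hε hεa x hx hg
  obtain ⟨hx0, hx1⟩ := hx
  have hae : a * ε < 1 / 2 := by
    rw [lt_div_iff₀ (by positivity)] at hεa
    linarith
  have hae0 : 0 < a * ε := by positivity
  obtain ⟨d, hd⟩ : ∃ d, d = (a * ε) ^ 2 / 6 := ⟨_, rfl⟩
  have hd0 : 0 < d := by rw [hd]; positivity
  have hd1 : d < 1 / 24 := by rw [hd]; nlinarith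
  obtain ⟨hxpos, hxd⟩ := aux_g x d hx0 hd0 (by linarith) (by rw [hg, hd]; ring)
  obtain ⟨u, hu⟩ : ∃ u, u = (1 - x) ^ 2 / x := ⟨_, rfl⟩
  have hux : u * x = (1 - x) ^ 2 := by rw [hu]; field_simp
  have hu0 : 0 ≤ u := by rw [hu]; positivity
  have hud : u = d * (6 + u) := by
    have : u * x = d * (6 + u) * x := by linear_combination hux + hxd - d * hux
    exact mul_right_cancel₀ hxpos.ne' this
  have hu1 : u ≤ 1 := by nlinarith
  have hu7 : u ≤ 7 * d := by nlinarith
  have hP := (auxP_ge s u hu0).1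
  have h6 : 6 + u ≠ 0 := by positivity
  have hd' : d = u / (6 + u) := by rw [eq_div_iff h6]; exact hud.symm
  have hSu := hS u
  have hKu : |S u| ≤ K := hK u ⟨hu0, hu1⟩
  rw [aux_Rfun s x u hxpos hx1 hux]
  have e4 : a ^ 4 * ε ^ 4 = 36 * (u / (6 + u)) ^ 2 := by rw [← hd', hd]; ring
  have e6 : a ^ 6 * ε ^ 6 = 216 * (u / (6 + u)) ^ 3 := by rw [← hd', hd]; ring
  have e8 : u ^ 4 ≤ 2 * a ^ 8 * ε ^ 8 := by
    calc u ^ 4 ≤ (7 * d) ^ 4 := by gcongr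
      _ = (7 / 6) ^ 4 * (a ^ 8 * ε ^ 8) := by rw [hd]; ring
      _ ≤ 2 * (a ^ 8 * ε ^ 8) := by gcongr; norm_num
      _ = _ := by ring
  have hq1 : (s : ℝ) + 1 ≠ 0 := by positivity
  have hq2 : (s : ℝ) + 2 ≠ 0 := by positivity
  have hP0 : auxP s u ≠ 0 := by linarith
  have h3 : 3 + u ≠ 0 := by positivity
  have main : ∀ T0 T2 T3 : ℝ, 2 * (auxP s u - 1) * (6 + u) ^ 4 - (6 + 2 * u) * auxP s u *
        (T0 * (6 + u) ^ 3 - T2 * u ^ 2 * (6 + u) + T3 * u ^ 3) = u ^ 4 * S u →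
      |(6 + u) / (3 + u) * ((auxP s u - 1) / auxP s u) -
        (T0 - T2 * (u / (6 + u)) ^ 2 + T3 * (u / (6 + u)) ^ 3)| ≤ u ^ 4 * (K + 1) := by
    intro T0 T2 T3 h
    have e : (6 + u) / (3 + u) * ((auxP s u - 1) / auxP s u) -
        (T0 - T2 * (u / (6 + u)) ^ 2 + T3 * (u / (6 + u)) ^ 3)
        = u ^ 4 * S u / ((6 + 2 * u) * (6 + u) ^ 3 * auxP s u) := by
      rw [← h, show 6 + 2 * u = 2 * (3 + u) by ring]
      field_simp
    have hden : 1 ≤ (6 + 2 * u) * (6 + u) ^ 3 * auxP s u := by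
      have a1 : 1 ≤ 6 + 2 * u := by linarith
      have a2 : 1 ≤ (6 + u) ^ 3 := one_le_pow₀ (by linarith)
      exact one_le_mul_of_one_le_of_one_le (one_le_mul_of_one_le_of_one_le a1 a2) hP
    rw [e, abs_div, abs_of_pos (by linarith : 0 < (6 + 2 * u) * (6 + u) ^ 3 * auxP s u), abs_mul,
      abs_of_nonneg (by positivity : 0 ≤ u ^ 4)]
    refine (div_le_self (by positivity) hden).trans ?_
    gcongr
    linarith
  have hm := main _ _ _ hSu
  refine le_trans (le_of_eq ?_) (hm.trans ?_)
  · congr 2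
    rw [mul_assoc _ (a ^ 4) (ε ^ 4), mul_assoc _ (a ^ 6) (ε ^ 6), e4, e6]
    ring
  · calc u ^ 4 * (K + 1) ≤ 2 * a ^ 8 * ε ^ 8 * (K + 1) := by gcongr
      _ = _ := by ring
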